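/- arXiv:2204.00412 — 2 statements merged into one kernel-verified Lean document; each statement's English description precedes it below -/
import Mathlib

section
/- Let h be a positive integer. For every multiplicative basis A of order h for ℤ⁺ (i.e., A ∈ MB_h), one has limsup_{x→∞} A(x) · (log x)^{1-1/h} / x ≥ (h!)^{1/h} / Γ(1/h). -/
open Filter Real

/-- Counting function: `A(x) = |A ∩ {1,…,⌊x⌋}|`. -/
noncomputable def cntF (A : Set ℕ) (x : ℝ) : ℕ := (A ∩ Set.Icc 1 ⌊x⌋₊).ncard

/-- Multiplicative representation function of order `h`:
`S_{A,h}(n) = #{(a_1,…,a_h) ∈ A^h : a_1⋯a_h = n}`. -/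
noncomputable def mulRep (h : ℕ) (A : Set ℕ) (n : ℕ) : ℕ :=
  {f : Fin h → ℕ | (∀ i, f i ∈ A) ∧ ∏ i, f i = n}.ncard

/-- `A` is a multiplicative basis of order `h` for `ℤ⁺`. -/
def IsMB (h : ℕ) (A : Set ℕ) : Prop := ∀ n : ℕ, 1 ≤ n → 1 ≤ mulRep h A n

namespace Finset

lemma sum_filter_eq_prod_le {h : ℕ} (S : Finset ℕ) (g : ℕ → ℝ) (hg : ∀ n, 0 ≤ g n)
    {i j : Fin h} (hij : i ≠ j) :
    ∑ f ∈ Fintype.piFinset (fun _ : Fin h => S) with f i = f j, ∏ k, g (f k) ≤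
      (∑ a ∈ S, g a ^ 2) * (∑ a ∈ S, g a) ^ (h - 2) := by
  classical
  rw [← sum_fiberwise_of_maps_to (s := (Fintype.piFinset (fun _ : Fin h => S)).filter
    (fun f => f i = f j)) (t := S) (g := fun f => f i)
    (fun f hf => Fintype.mem_piFinset.1 (mem_filter.1 hf).1 i), sum_mul]
  refine sum_le_sum fun a ha => ?_
  have hsub : ((Fintype.piFinset (fun _ : Fin h => S)).filter (fun f => f i = f j)).filter
      (fun f => f i = a) ⊆
      Fintype.piFinset (fun k : Fin h => if k ∈ ({i, j} : Finset (Fin h)) then {a} else S) := by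
    intro f hf
    simp only [mem_filter, Fintype.mem_piFinset] at hf ⊢
    obtain ⟨⟨h1, h2⟩, h3⟩ := hf
    intro k
    split_ifs with hk
    · rcases mem_insert.1 hk with rfl | hk
      · simpa using h3
      · rw [mem_singleton.1 hk, ← h2]; simpa using h3
    · exact h1 k
  refine (sum_le_sum_of_subset_of_nonneg hsub
    fun f _ _ => prod_nonneg fun k _ => hg _).trans_eq ?_
  rw [← prod_univ_sum (fun k : Fin h => if k ∈ ({i, j} : Finset (Fin h)) then {a} else S)
    (fun _ => g)]
  have : ∀ k : Fin h, ∑ b ∈ (if k ∈ ({i, j} : Finset (Fin h)) then {a} else S), g b =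
      if k ∈ ({i, j} : Finset (Fin h)) then g a else ∑ b ∈ S, g b := by
    intro k
    split_ifs <;> simp
  simp_rw [this]
  rw [prod_ite, prod_const, prod_const, filter_mem_eq_inter, univ_inter, card_pair hij,
    filter_notMem_eq_sdiff, card_sdiff_of_subset (subset_univ _), card_pair hij, card_univ,
    Fintype.card_fin]

lemma factorial_mul_le_sum {h : ℕ} (S : Finset ℕ) (g : ℕ → ℝ) (hg : ∀ n, 0 ≤ g n)
    (hmul : ∀ f : Fin h → ℕ, ∏ k, g (f k) = g (∏ k, f k)) {n : ℕ} {f : Fin h → ℕ}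
    (hfS : ∀ k, f k ∈ S) (hf : ∏ k, f k = n) :
    (h.factorial : ℝ) * g n ≤
      ∑ f ∈ Fintype.piFinset (fun _ : Fin h => S) with ∏ k, f k = n, ∏ k, g (f k) +
      h.factorial * ∑ p ∈ (univ : Finset (Fin h)).offDiag,
        ∑ f ∈ (Fintype.piFinset (fun _ : Fin h => S)).filter (fun f => f p.1 = f p.2)
          with ∏ k, f k = n, ∏ k, g (f k) := by
  classical
  have hnn : ∀ f : Fin h → ℕ, 0 ≤ ∏ k, g (f k) := fun f => prod_nonneg fun k _ => hg _
  have hfact : (0 : ℝ) ≤ h.factorial := Nat.cast_nonneg _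
  by_cases hinj : Function.Injective f
  · refine le_add_of_le_of_nonneg ?_ (mul_nonneg hfact
      (sum_nonneg fun p _ => sum_nonneg fun f _ => hnn f))
    have hcard : ((univ : Finset (Equiv.Perm (Fin h))).image (fun σ : Equiv.Perm (Fin h) => f ∘ ⇑σ)).card =
        h.factorial := by
      rw [card_image_of_injective, card_univ, Fintype.card_perm, Fintype.card_fin]
      intro σ τ hστ
      ext k
      exact congrArg Fin.val (hinj (congrFun hστ k))
    have hsub : (univ : Finset (Equiv.Perm (Fin h))).image (fun σ : Equiv.Perm (Fin h) => f ∘ ⇑σ) ⊆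
        (Fintype.piFinset (fun _ : Fin h => S)).filter (fun f => ∏ k, f k = n) := by
      intro f' hf'
      obtain ⟨σ, -, rfl⟩ := mem_image.1 hf'
      simp only [mem_filter, Fintype.mem_piFinset, Function.comp_apply]
      exact ⟨fun k => hfS _, by rw [← hf]; exact Equiv.prod_comp σ f⟩
    refine le_trans (le_of_eq ?_) (sum_le_sum_of_subset_of_nonneg hsub fun f _ _ => hnn f)
    rw [← hcard, ← nsmul_eq_mul, ← sum_const]
    refine sum_congr rfl fun f' hf' => ?_
    rw [hmul, (mem_filter.1 (hsub hf')).2]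
  · refine le_add_of_nonneg_of_le (sum_nonneg fun f _ => hnn f)
      (mul_le_mul_of_nonneg_left ?_ hfact)
    simp only [Function.Injective, not_forall] at hinj
    obtain ⟨i, j, hfij, hij⟩ := hinj
    have hmem : f ∈ ((Fintype.piFinset (fun _ : Fin h => S)).filter
        (fun f => f i = f j)).filter (fun f => ∏ k, f k = n) := by
      simp only [mem_filter, Fintype.mem_piFinset]
      exact ⟨⟨hfS, hfij⟩, hf⟩
    have hp : (i, j) ∈ (univ : Finset (Fin h)).offDiag := by simpa using hij
    set F : Fin h × Fin h → ℝ := fun p =>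
      ∑ f ∈ (Fintype.piFinset (fun _ : Fin h => S)).filter (fun f => f p.1 = f p.2)
          with ∏ k, f k = n, ∏ k, g (f k)
    have hF0 : ∀ p ∈ (univ : Finset (Fin h)).offDiag, 0 ≤ F p :=
      fun p _ => sum_nonneg fun f _ => hnn f
    refine le_trans ?_ (single_le_sum hF0 hp)
    rw [← hf, ← hmul]
    exact single_le_sum (f := fun f : Fin h → ℕ => ∏ k, g (f k)) (fun f _ => hnn f) hmem

lemma factorial_mul_sum_le {h : ℕ} (S T : Finset ℕ) (g : ℕ → ℝ) (hg : ∀ n, 0 ≤ g n)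
    (hmul : ∀ f : Fin h → ℕ, ∏ k, g (f k) = g (∏ k, f k))
    (hrep : ∀ n ∈ T, ∃ f : Fin h → ℕ, (∀ k, f k ∈ S) ∧ ∏ k, f k = n) :
    (h.factorial : ℝ) * ∑ n ∈ T, g n ≤ (∑ a ∈ S, g a) ^ h +
      h.factorial * ((univ : Finset (Fin h)).offDiag.card *
        ((∑ a ∈ S, g a ^ 2) * (∑ a ∈ S, g a) ^ (h - 2))) := by
  classical
  have hnn : ∀ f : Fin h → ℕ, 0 ≤ ∏ k, g (f k) := fun f => prod_nonneg fun k _ => hg _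
  have hfact : (0 : ℝ) ≤ h.factorial := Nat.cast_nonneg _
  rw [mul_sum]
  refine (sum_le_sum (g := fun n =>
      ∑ f ∈ Fintype.piFinset (fun _ : Fin h => S) with ∏ k, f k = n, ∏ k, g (f k) +
      h.factorial * ∑ p ∈ (univ : Finset (Fin h)).offDiag,
        ∑ f ∈ (Fintype.piFinset (fun _ : Fin h => S)).filter (fun f => f p.1 = f p.2)
          with ∏ k, f k = n, ∏ k, g (f k)) fun n hn => ?_).trans ?_
  · obtain ⟨f, hfS, hf⟩ := hrep n hn
    exact factorial_mul_le_sum S g hg hmul hfS hf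
  · rw [sum_add_distrib, ← mul_sum, sum_comm, sum_pow']
    refine add_le_add ?_ (mul_le_mul_of_nonneg_left ?_ hfact)
    · exact sum_fiberwise_le_sum_of_sum_fiber_nonneg fun _ _ => sum_nonneg fun f _ => hnn f
    · rw [← nsmul_eq_mul]
      refine sum_le_card_nsmul _ _ _ fun p hp => ?_
      refine le_trans (sum_fiberwise_le_sum_of_sum_fiber_nonneg
        fun _ _ => sum_nonneg fun f _ => hnn f) ?_
      exact sum_filter_eq_prod_le S g hg (mem_offDiag.1 hp).2.2

end Finset

open MeasureTheory in
lemma sum_rpow_neg_le {A : Set ℕ} {S : Finset ℕ} (hS : ∀ a ∈ S, a ∈ A ∧ 1 ≤ a) {α c M s : ℝ}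
    (hα : 0 < α) (hs : 1 < s)
    (hA : ∀ u : ℝ, 0 < u → (cntF A (exp u) : ℝ) ≤ c * (exp u * u ^ (α - 1)) + M) :
    ∑ a ∈ S, (a : ℝ) ^ (-s) ≤ s * (c * ((1 / (s - 1)) ^ α * Gamma α)) + M := by
  have hs0 : 0 < s := by linarith
  have hint0 : ∀ b : ℝ, IntegrableOn (fun u : ℝ => exp (-s * u)) (Set.Ioi b) :=
    fun b => integrableOn_exp_mul_Ioi (by linarith) b
  have hterm : ∀ a ∈ S, (a : ℝ) ^ (-s) =
      s * ∫ u in Set.Ioi (0 : ℝ), (Set.Ioi (log a)).indicator (fun u => exp (-s * u)) u := by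
    intro a ha
    have ha1 : (1 : ℝ) ≤ a := by exact_mod_cast (hS a ha).2
    rw [setIntegral_indicator measurableSet_Ioi, Set.inter_eq_self_of_subset_right
      (Set.Ioi_subset_Ioi (log_nonneg ha1)), integral_exp_mul_Ioi (by linarith),
      rpow_def_of_pos (by linarith)]
    field_simp
  have hGam : ∫ u in Set.Ioi (0 : ℝ), u ^ (α - 1) * exp (-((s - 1) * u)) =
      (1 / (s - 1)) ^ α * Gamma α := integral_rpow_mul_exp_neg_mul_Ioi hα (by linarith)
  have hGi : IntegrableOn (fun u : ℝ => u ^ (α - 1) * exp (-((s - 1) * u))) (Set.Ioi 0) := by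
    refine Integrable.of_integral_ne_zero ?_
    rw [hGam]
    have h1 : 0 < 1 / (s - 1) := by have : 0 < s - 1 := by linarith
                                    positivity
    exact (mul_pos (rpow_pos_of_pos h1 _) (Gamma_pos_of_pos hα)).ne'
  have hMi : ∫ u in Set.Ioi (0 : ℝ), exp (-s * u) = 1 / s := by
    rw [integral_exp_mul_Ioi (by linarith)]
    simp [neg_div_neg_eq]
  rw [Finset.sum_congr rfl hterm, ← Finset.mul_sum, ← integral_finsetSum _
    (fun a _ => (hint0 0).indicator measurableSet_Ioi)]
  have key : ∫ u in Set.Ioi (0 : ℝ),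
      ∑ a ∈ S, (Set.Ioi (log a)).indicator (fun u => exp (-s * u)) u ≤
      ∫ u in Set.Ioi (0 : ℝ),
        (c * (u ^ (α - 1) * exp (-((s - 1) * u))) + M * exp (-s * u)) := by
    refine setIntegral_mono_on (integrable_finsetSum _
      (fun a _ => (hint0 0).indicator measurableSet_Ioi))
      ((hGi.const_mul c).add ((hint0 0).const_mul M)) measurableSet_Ioi fun u hu => ?_
    have h1 : ∑ a ∈ S, (Set.Ioi (log a)).indicator (fun u => exp (-s * u)) u ≤
        cntF A (exp u) * exp (-s * u) := by
      simp only [Set.indicator_apply]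
      rw [← Finset.sum_filter, Finset.sum_const, nsmul_eq_mul]
      refine mul_le_mul_of_nonneg_right ?_ (exp_pos _).le
      rw [Nat.cast_le, ← Set.ncard_coe_finset, cntF]
      refine Set.ncard_le_ncard ?_ ((Set.finite_Icc _ _).inter_of_right _)
      intro a ha
      simp only [Finset.coe_filter, Set.mem_ofPred_eq, Set.mem_Ioi] at ha
      have ha1 := (hS a ha.1).2
      refine ⟨(hS a ha.1).1, ha1, Nat.le_floor ?_⟩
      exact ((log_lt_iff_lt_exp (by exact_mod_cast ha1)).1 ha.2).le
    refine h1.trans ((mul_le_mul_of_nonneg_right (hA u hu) (exp_pos _).le).trans_eq ?_)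
    have : exp (-((s - 1) * u)) = exp u * exp (-s * u) := by rw [← exp_add]; ring_nf
    rw [this]
    ring
  rw [integral_add (hGi.const_mul c) ((hint0 0).const_mul M), integral_const_mul,
    integral_const_mul, hGam, hMi] at key
  refine (mul_le_mul_of_nonneg_left key hs0.le).trans_eq ?_
  field_simp

lemma cntF_le (A : Set ℕ) {x : ℝ} (hx : 0 ≤ x) : (cntF A x : ℝ) ≤ x := by
  refine le_trans (Nat.cast_le.2 ?_) (Nat.floor_le hx)
  refine (Set.ncard_le_ncard Set.inter_subset_right (Set.finite_Icc _ _)).trans_eq ?_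
  rw [← Finset.coe_Icc, Set.ncard_coe_finset, Nat.card_Icc, Nat.add_sub_cancel]

lemma cntF_exp_le_of_eventually_lt {A : Set ℕ} {α c : ℝ}
    (hev : ∀ᶠ x : ℝ in atTop, (cntF A x : ℝ) * log x ^ (1 - α) / x < c) :
    0 ≤ c ∧ ∃ M : ℝ, ∀ u : ℝ, 0 < u →
      (cntF A (exp u) : ℝ) ≤ c * (exp u * u ^ (α - 1)) + M := by
  obtain ⟨X, hX⟩ := eventually_atTop.1 hev
  have hc : 0 ≤ c := by
    refine le_trans ?_ (hX (max X 1) (le_max_left _ _)).le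
    have := log_nonneg (le_max_right X 1)
    have : 0 ≤ max X 1 := zero_le_one.trans (le_max_right X 1)
    positivity
  refine ⟨hc, max X 0, fun u hu => ?_⟩
  rcases le_or_gt X (exp u) with h | h
  · have h1 := hX _ h
    rw [log_exp, div_lt_iff₀ (exp_pos u)] at h1
    refine le_add_of_le_of_nonneg ?_ (le_max_right _ _)
    have hpow : u ^ (1 - α) * u ^ (α - 1) = 1 := by
      rw [← rpow_add hu]; simp
    calc (cntF A (exp u) : ℝ) = cntF A (exp u) * u ^ (1 - α) * u ^ (α - 1) := by
          rw [mul_assoc, hpow, mul_one]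
      _ ≤ c * exp u * u ^ (α - 1) :=
          mul_le_mul_of_nonneg_right h1.le (rpow_nonneg hu.le _)
      _ = _ := by ring
  · exact le_add_of_nonneg_of_le (by positivity)
      ((cntF_le A (exp_pos u).le).trans (h.le.trans (le_max_left _ _)))

lemma IsMB.exists_prod_eq {h : ℕ} {A : Set ℕ} (hMB : IsMB h A) {n : ℕ} (hn : 1 ≤ n) :
    ∃ f : Fin h → ℕ, (∀ i, f i ∈ A) ∧ ∏ i, f i = n :=
  Set.nonempty_of_ncard_ne_zero (Nat.one_le_iff_ne_zero.1 (hMB n hn))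

lemma IsMB.factorial_mul_tsum_le {h : ℕ} {A : Set ℕ} (hMB : IsMB h A) {s V : ℝ} (hs : 1 < s)
    (hV : ∀ S : Finset ℕ, (∀ a ∈ S, a ∈ A ∧ 1 ≤ a) → ∑ a ∈ S, (a : ℝ) ^ (-s) ≤ V) :
    (h.factorial : ℝ) * ∑' n : ℕ, 1 / (n : ℝ) ^ s ≤ V ^ h + h.factorial *
      ((Finset.univ : Finset (Fin h)).offDiag.card *
        ((∑' n : ℕ, 1 / (n : ℝ) ^ 2) * V ^ (h - 2))) := by
  classical
  have hfact : (0 : ℝ) < h.factorial := Nat.cast_pos.2 h.factorial_pos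
  rw [mul_comm, ← le_div_iff₀ hfact]
  refine Real.tsum_le_of_sum_range_le (fun n => by positivity) fun N => ?_
  rw [le_div_iff₀ hfact, mul_comm]
  set S : Finset ℕ := (Finset.Icc 1 N).filter (· ∈ A) with hS
  have hg : ∀ n : ℕ, 0 ≤ (n : ℝ) ^ (-s) := fun n => by positivity
  have hsum : ∑ n ∈ Finset.range N, 1 / (n : ℝ) ^ s =
      ∑ n ∈ (Finset.range N).erase 0, (n : ℝ) ^ (-s) := by
    rw [Finset.sum_erase]
    · exact Finset.sum_congr rfl fun n _ => by rw [rpow_neg (Nat.cast_nonneg n), one_div]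
    · rw [Nat.cast_zero, zero_rpow (by linarith)]
  have hSA : ∀ a ∈ S, a ∈ A ∧ 1 ≤ a := fun a ha => by
    simp only [hS, Finset.mem_filter, Finset.mem_Icc] at ha
    exact ⟨ha.2, ha.1.1⟩
  have hS0 : 0 ≤ ∑ a ∈ S, (a : ℝ) ^ (-s) := Finset.sum_nonneg fun a _ => hg a
  have hSV := hV S hSA
  have hsq : ∑ a ∈ S, ((a : ℝ) ^ (-s)) ^ 2 ≤ ∑' n : ℕ, 1 / (n : ℝ) ^ 2 := by
    refine (Finset.sum_le_sum fun a ha => ?_).trans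
      ((Real.summable_one_div_nat_pow.2 one_lt_two).sum_le_tsum S fun n _ => by positivity)
    have ha1 : (1 : ℝ) ≤ a := by exact_mod_cast (hSA a ha).2
    rw [one_div, ← inv_pow, ← rpow_neg_one]
    exact pow_le_pow_left₀ (hg a) (rpow_le_rpow_of_exponent_le ha1 (by linarith)) 2
  rw [hsum]
  refine (Finset.factorial_mul_sum_le S _ (fun n : ℕ => (n : ℝ) ^ (-s)) hg (fun f => ?_)
    fun n hn => ?_).trans ?_
  · rw [Real.finsetProd_rpow _ _ fun i _ => Nat.cast_nonneg _, Nat.cast_prod]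
  · obtain ⟨hn0, hnN⟩ := Finset.mem_erase.1 hn
    obtain ⟨f, hfA, hf⟩ := hMB.exists_prod_eq (Nat.one_le_iff_ne_zero.2 hn0)
    refine ⟨f, fun k => ?_, hf⟩
    have hdvd : f k ∣ n := hf ▸ Finset.dvd_prod_of_mem f (Finset.mem_univ k)
    have hnpos := Nat.pos_of_ne_zero hn0
    exact Finset.mem_filter.2 ⟨Finset.mem_Icc.2 ⟨Nat.pos_of_dvd_of_pos hdvd hnpos,
      (Nat.le_of_dvd hnpos hdvd).trans (Finset.mem_range.1 hnN).le⟩, hfA k⟩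
  · gcongr

open Topology in
lemma IsMB.factorial_le_pow {h : ℕ} (hh : 1 ≤ h) {A : Set ℕ} (hMB : IsMB h A) {c M : ℝ}
    (hA : ∀ u : ℝ, 0 < u →
      (cntF A (exp u) : ℝ) ≤ c * (exp u * u ^ ((1 : ℝ) / h - 1)) + M) :
    (h.factorial : ℝ) ≤ (c * Gamma (1 / h)) ^ h := by
  have hh0 : (0 : ℝ) < h := Nat.cast_pos.2 hh
  have hα : (0 : ℝ) < 1 / h := by positivity
  set K : ℝ := h.factorial * ((Finset.univ : Finset (Fin h)).offDiag.card *
    ∑' n : ℕ, 1 / (n : ℝ) ^ 2) with hK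
  set W : ℝ → ℝ := fun s => s * (c * Gamma (1 / h)) + M * (s - 1) ^ ((1 : ℝ) / h) with hW
  have hle : ∀ᶠ s : ℝ in 𝓝[>] 1,
      (h.factorial : ℝ) * ((s - 1) * ∑' n : ℕ, 1 / (n : ℝ) ^ s) ≤
        W s ^ h + K * (W s ^ (h - 2) * ((s - 1) ^ ((1 : ℝ) / h)) ^ (h - (h - 2))) := by
    filter_upwards [self_mem_nhdsWithin] with s hs
    have hs1 : 0 < s - 1 := sub_pos.2 hs
    set V := s * (c * ((1 / (s - 1)) ^ ((1 : ℝ) / h) * Gamma (1 / h))) + M with hV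
    set t := (s - 1) ^ ((1 : ℝ) / h) with ht
    have ht0 : 0 < t := rpow_pos_of_pos hs1 _
    have hth : t ^ h = s - 1 := by
      rw [ht, ← rpow_natCast, ← rpow_mul hs1.le, one_div_mul_cancel hh0.ne', rpow_one]
    have hWV : W s = t * V := by
      change s * (c * Gamma (1 / h)) + M * t = t * V
      rw [hV, one_div (s - 1), inv_rpow hs1.le, ← ht]
      field_simp
    have hth2 : t ^ (h - 2) * t ^ (h - (h - 2)) = s - 1 := by
      rw [← pow_add, ← hth]; congr 1; omega
    have key := hMB.factorial_mul_tsum_le hs (V := V)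
      fun S hS => sum_rpow_neg_le hS hα hs hA
    calc (h.factorial : ℝ) * ((s - 1) * ∑' n : ℕ, 1 / (n : ℝ) ^ s)
        = (s - 1) * (h.factorial * ∑' n : ℕ, 1 / (n : ℝ) ^ s) := by ring
      _ ≤ (s - 1) * (V ^ h + h.factorial * ((Finset.univ : Finset (Fin h)).offDiag.card *
          ((∑' n : ℕ, 1 / (n : ℝ) ^ 2) * V ^ (h - 2)))) :=
          mul_le_mul_of_nonneg_left key hs1.le
      _ = (s - 1) * V ^ h + K * ((s - 1) * V ^ (h - 2)) := by rw [hK]; ring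
      _ = _ := by
          rw [hWV, mul_pow, mul_pow, hth]
          linear_combination (-K * V ^ (h - 2)) * hth2
  have ht : Tendsto (fun s : ℝ => (s - 1) ^ ((1 : ℝ) / h)) (𝓝[>] 1) (𝓝 0) := by
    have hcont : ContinuousAt (fun s : ℝ => (s - 1) ^ ((1 : ℝ) / h)) 1 :=
      (continuousAt_id.sub continuousAt_const).rpow_const (Or.inr hα.le)
    have := hcont.tendsto
    rw [sub_self, zero_rpow hα.ne'] at this
    exact this.mono_left nhdsWithin_le_nhds
  have hWt : Tendsto W (𝓝[>] 1) (𝓝 (1 * (c * Gamma (1 / h)) + M * 0)) :=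
    ((tendsto_id.mono_left nhdsWithin_le_nhds).mul_const _).add (ht.const_mul M)
  have := le_of_tendsto_of_tendsto (tendsto_sub_mul_tsum_nat_rpow.const_mul (h.factorial : ℝ))
    ((hWt.pow h).add (((hWt.pow (h - 2)).mul (ht.pow (h - (h - 2)))).const_mul K)) hle
  have hne : h - (h - 2) ≠ 0 := by omega
  simpa [zero_pow hne] using this

theorem stmt0 (h : ℕ) (hh : 1 ≤ h) (A : Set ℕ) (hA0 : 0 ∉ A) (hMB : IsMB h A) :
    (((Nat.factorial h : ℝ) ^ ((1 : ℝ) / h) / Real.Gamma (1 / h) : ℝ) : EReal) ≤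
      Filter.limsup (fun x : ℝ =>
        (((cntF A x : ℝ) * Real.log x ^ (1 - 1 / (h : ℝ)) / x : ℝ) : EReal))
        Filter.atTop := by
  have hh0 : (0 : ℝ) < h := Nat.cast_pos.2 hh
  have hΓ : 0 < Gamma (1 / h) := Gamma_pos_of_pos (by positivity)
  by_contra! hlt
  obtain ⟨c, hc1, hc2⟩ := EReal.lt_iff_exists_real_btwn.1 hlt
  have hev : ∀ᶠ x : ℝ in atTop, (cntF A x : ℝ) * log x ^ (1 - 1 / (h : ℝ)) / x < c :=
    (eventually_lt_of_limsup_lt hc1).mono fun x hx => EReal.coe_lt_coe_iff.1 hx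
  obtain ⟨hc, M, hM⟩ := cntF_exp_le_of_eventually_lt hev
  have hle := hMB.factorial_le_pow hh hM
  have hc3 := (lt_div_iff₀ hΓ).1 (EReal.coe_lt_coe_iff.1 hc2)
  have hpow := pow_lt_pow_left₀ hc3 (by positivity) (Nat.one_le_iff_ne_zero.1 hh)
  rw [one_div, rpow_inv_natCast_pow (Nat.cast_nonneg _) (Nat.one_le_iff_ne_zero.1 hh),
    ← one_div] at hpow
  exact hpow.not_ge hle
end

section
/- Let h ∈ ℤ⁺ and A_1,…,A_h ⊆ ℤ⁺. Let τ_1,…,τ_h ∈ (0,1) with τ_1 + ⋯ + τ_h = 1, and assume limsup_{x→∞} A_i(x) · (log x)^{1-τ_i} / x < ∞ for every 1 ≤ i ≤ h. Then (liminf_{x→∞} (1/x) ∑_{n≤x} S_{A_1,…,A_h}(n)) · ∏_{i=1}^h (1/Γ(τ_i)) ≤ ∏_{i=1}^h limsup_{x→∞} A_i(x) · (log x)^{1-τ_i} / x. -/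
open Filter Real

/-- Common multiplicative representation function:
`S_{A_1,…,A_h}(n) = #{(a_1,…,a_h) : a_i ∈ A_i, a_1⋯a_h = n}`. -/
noncomputable def mulRepFam (h : ℕ) (A : Fin h → Set ℕ) (n : ℕ) : ℕ :=
  {f : Fin h → ℕ | (∀ i, f i ∈ A i) ∧ ∏ i, f i = n}.ncard

open MeasureTheory

lemma lintegral_Ici_mul_exp_neg {s : ℝ} (hs : 0 < s) (a c : ℝ) (hc : 0 ≤ c) :
    ∫⁻ u in Set.Ici a, ENNReal.ofReal (c * Real.exp (-s * u)) =
      ENNReal.ofReal (c * (Real.exp (-s * a) / s)) := by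
  rw [setLIntegral_congr Ioi_ae_eq_Ici.symm, ← ofReal_integral_eq_lintegral_ofReal
    ((integrableOn_exp_mul_Ioi (neg_lt_zero.2 hs) a).const_mul c)
    (Eventually.of_forall fun u => mul_nonneg hc (Real.exp_nonneg _)),
    integral_const_mul, integral_exp_mul_Ioi (neg_lt_zero.2 hs), neg_div_neg_eq]

lemma lintegral_Ioi_mul_rpow_mul_exp_neg {σ t c : ℝ} (hσ : 0 < σ) (ht : 0 < t) (hc : 0 ≤ c) :
    ∫⁻ u in Set.Ioi (0 : ℝ), ENNReal.ofReal (c * (u ^ (t - 1) * Real.exp (-(σ * u)))) =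
      ENNReal.ofReal (c * ((1 / σ) ^ t * Real.Gamma t)) := by
  have hint : IntegrableOn (fun u : ℝ => u ^ (t - 1) * Real.exp (-(σ * u))) (Set.Ioi 0) := by
    simpa using integrableOn_rpow_mul_exp_neg_mul_rpow (s := t - 1) (by linarith) one_pos hσ
  rw [← ofReal_integral_eq_lintegral_ofReal (hint.const_mul c), integral_const_mul,
    Real.integral_rpow_mul_exp_neg_mul_Ioi ht hσ]
  filter_upwards [ae_restrict_mem measurableSet_Ioi] with u hu
  have : (0 : ℝ) < u := hu
  simp only [Pi.zero_apply]
  positivity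

/-- Abel summation for a Dirichlet series with nonnegative coefficients, in the variable
`u = log x`. -/
lemma tsum_ofReal_mul_rpow_neg_eq_lintegral {f : ℕ → ℝ} (hf : ∀ n, 0 ≤ f n) {s : ℝ} (hs : 0 < s) :
    ∑' n : ℕ, ENNReal.ofReal (f n * (n : ℝ) ^ (-s)) =
      ∫⁻ u : ℝ, ENNReal.ofReal ((∑ n ∈ Finset.Icc 1 ⌊Real.exp u⌋₊, f n) *
        (s * Real.exp (-s * u))) := by
  have key : ∀ u : ℝ, ENNReal.ofReal ((∑ n ∈ Finset.Icc 1 ⌊Real.exp u⌋₊, f n) *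
        (s * Real.exp (-s * u))) = ∑' n : ℕ, if 1 ≤ n then
          (Set.Ici (Real.log n)).indicator
            (fun u => ENNReal.ofReal ((f n * s) * Real.exp (-s * u))) u else 0 := by
    intro u
    rw [Finset.sum_mul, ENNReal.ofReal_sum_of_nonneg fun n _ =>
      mul_nonneg (hf n) (mul_nonneg hs.le (Real.exp_nonneg _))]
    rw [tsum_eq_sum (s := Finset.Icc 1 ⌊Real.exp u⌋₊)]
    · refine Finset.sum_congr rfl fun n hn => ?_
      rw [Finset.mem_Icc] at hn
      have hn0 : (0 : ℝ) < n := by exact_mod_cast hn.1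
      have hle : (n : ℝ) ≤ Real.exp u := (Nat.le_floor_iff (Real.exp_nonneg u)).1 hn.2
      rw [if_pos hn.1, Set.indicator_of_mem
        (by simpa using (Real.log_le_iff_le_exp hn0).2 hle), mul_assoc]
    · intro n hn
      split_ifs with h1
      · have hn0 : (0 : ℝ) < n := by exact_mod_cast h1
        refine Set.indicator_of_notMem (fun hu => hn ?_) _
        exact Finset.mem_Icc.2 ⟨h1, Nat.le_floor ((Real.log_le_iff_le_exp hn0).1 hu)⟩
      · rfl
  simp_rw [key]
  rw [lintegral_tsum]
  · refine tsum_congr fun n => ?_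
    split_ifs with h1
    · have hn0 : (0 : ℝ) < n := by exact_mod_cast h1
      rw [lintegral_indicator measurableSet_Ici,
        lintegral_Ici_mul_exp_neg hs _ _ (mul_nonneg (hf n) hs.le)]
      congr 1
      rw [Real.rpow_def_of_pos hn0, mul_comm (-s)]
      field_simp
    · obtain rfl : n = 0 := by omega
      simp [Real.zero_rpow (neg_ne_zero.2 hs.ne')]
  · intro n
    split_ifs
    · exact ((by fun_prop : Measurable fun u : ℝ =>
        ENNReal.ofReal ((f n * s) * Real.exp (-s * u))).indicator measurableSet_Ici).aemeasurable
    · exact aemeasurable_const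

lemma dirichletSeries_le {f : ℕ → ℝ} (hf : ∀ n, 0 ≤ f n) (hf1 : ∀ n, f n ≤ 1)
    {c t u₀ : ℝ} (hc : 0 ≤ c) (ht : 0 < t) (hu₀ : 0 < u₀)
    (hbd : ∀ u, u₀ ≤ u →
      ∑ n ∈ Finset.Icc 1 ⌊Real.exp u⌋₊, f n ≤ c * (u ^ (t - 1) * Real.exp u))
    {σ : ℝ} (hσ : 0 < σ) :
    ∑' n : ℕ, ENNReal.ofReal (f n * (n : ℝ) ^ (-(1 + σ))) ≤
      ENNReal.ofReal (Real.exp u₀ + c * (1 + σ) * ((1 / σ) ^ t * Real.Gamma t)) := by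
  have hs : 0 < 1 + σ := by linarith
  rw [tsum_ofReal_mul_rpow_neg_eq_lintegral hf hs]
  have hGam := Real.Gamma_pos_of_pos ht
  rw [ENNReal.ofReal_add (by positivity) (by positivity)]
  have e1 := lintegral_Ici_mul_exp_neg hs 0 (Real.exp u₀ * (1 + σ)) (by positivity)
  have e2 := lintegral_Ioi_mul_rpow_mul_exp_neg hσ ht (c := c * (1 + σ)) (by positivity)
  rw [← lintegral_indicator measurableSet_Ici] at e1
  rw [← lintegral_indicator measurableSet_Ioi] at e2
  have e1' : Real.exp u₀ * (1 + σ) * (Real.exp (-(1 + σ) * 0) / (1 + σ)) = Real.exp u₀ := by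
    simp; field_simp
  rw [e1'] at e1
  rw [← e1, ← e2, ← lintegral_add_left]
  · refine lintegral_mono fun u => ?_
    rcases lt_or_ge u 0 with hu | hu
    · have : ⌊Real.exp u⌋₊ = 0 := Nat.floor_eq_zero.2 (by simpa using hu)
      simp [this]
    rcases lt_or_ge u u₀ with hu' | hu'
    · refine le_trans ?_ le_self_add
      rw [Set.indicator_of_mem (by exact hu)]
      refine ENNReal.ofReal_le_ofReal ?_
      rw [mul_assoc]
      gcongr
      calc ∑ n ∈ Finset.Icc 1 ⌊Real.exp u⌋₊, f n
          ≤ ∑ n ∈ Finset.Icc 1 ⌊Real.exp u⌋₊, (1 : ℝ) := Finset.sum_le_sum fun n _ => hf1 n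
        _ ≤ Real.exp u := by simpa using Nat.floor_le (Real.exp_nonneg u)
        _ ≤ Real.exp u₀ := Real.exp_le_exp.2 hu'.le
    · refine le_trans ?_ le_add_self
      rw [Set.indicator_of_mem (by exact lt_of_lt_of_le hu₀ hu')]
      refine ENNReal.ofReal_le_ofReal ?_
      calc _ ≤ c * (u ^ (t - 1) * Real.exp u) * ((1 + σ) * Real.exp (-(1 + σ) * u)) := by
            gcongr; exact hbd u hu'
        _ = _ := by
            rw [show -(σ * u) = u + -(1 + σ) * u by ring, Real.exp_add]; ring
  · exact (by fun_prop : Measurable fun u : ℝ => ENNReal.ofReal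
      (Real.exp u₀ * (1 + σ) * Real.exp (-(1 + σ) * u))).indicator measurableSet_Ici

lemma le_dirichletSeries {f : ℕ → ℝ} (hf : ∀ n, 0 ≤ f n) {l u₀ : ℝ} (hl : 0 ≤ l)
    (hbd : ∀ u, u₀ ≤ u → l * Real.exp u ≤ ∑ n ∈ Finset.Icc 1 ⌊Real.exp u⌋₊, f n)
    {σ : ℝ} (hσ : 0 < σ) :
    ENNReal.ofReal (l * (1 + σ) * (Real.exp (-σ * u₀) / σ)) ≤
      ∑' n : ℕ, ENNReal.ofReal (f n * (n : ℝ) ^ (-(1 + σ))) := by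
  have hs : 0 < 1 + σ := by linarith
  rw [tsum_ofReal_mul_rpow_neg_eq_lintegral hf hs,
    ← lintegral_Ici_mul_exp_neg hσ u₀ (l * (1 + σ)) (by positivity)]
  refine le_trans (setLIntegral_mono' measurableSet_Ici fun u hu => ?_)
    (setLIntegral_le_lintegral (Set.Ici u₀) _)
  refine ENNReal.ofReal_le_ofReal ?_
  calc _ = l * Real.exp u * ((1 + σ) * Real.exp (-(1 + σ) * u)) := by
        rw [show -σ * u = u + -(1 + σ) * u by ring, Real.exp_add]; ring
    _ ≤ _ := by gcongr; exact hbd u hu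

open Classical in
lemma mulRepFam_eq_card (h : ℕ) (A : Fin h → Set ℕ) (hA0 : ∀ i, 0 ∉ A i) {n N : ℕ} (hn : 1 ≤ n)
    (hnN : n ≤ N) : mulRepFam h A n = ((Fintype.piFinset fun i =>
      (Finset.Icc 1 N).filter (· ∈ A i)).filter fun f => ∏ i, f i = n).card := by
  rw [mulRepFam, ← Set.ncard_coe_finset]
  congr 1
  ext f
  simp only [Set.mem_ofPred_eq, Finset.coe_filter, Fintype.mem_piFinset, Finset.mem_filter,
    Finset.mem_Icc]
  refine ⟨fun ⟨h1, h2⟩ => ⟨fun i => ⟨⟨?_, ?_⟩, h1 i⟩, h2⟩, fun ⟨h1, h2⟩ => ⟨fun i => (h1 i).2, h2⟩⟩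
  · exact Nat.one_le_iff_ne_zero.2 fun h0 => hA0 i (h0 ▸ h1 i)
  · exact (Nat.le_of_dvd hn (h2 ▸ Finset.dvd_prod_of_mem f (Finset.mem_univ i))).trans hnN

open Classical in
lemma tsum_mulRepFam_le_prod (h : ℕ) (A : Fin h → Set ℕ) (hA0 : ∀ i, 0 ∉ A i) {s : ℝ}
    (hs : 0 < s) :
    ∑' n : ℕ, ENNReal.ofReal ((mulRepFam h A n : ℝ) * (n : ℝ) ^ (-s)) ≤
      ∏ i, ∑' n : ℕ, ENNReal.ofReal ((if n ∈ A i then 1 else 0) * (n : ℝ) ^ (-s)) := by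
  rw [ENNReal.tsum_eq_iSup_nat]
  refine iSup_le fun N => ?_
  let T : Fin h → Finset ℕ := fun i => (Finset.Icc 1 N).filter (· ∈ A i)
  let w : ℕ → ENNReal := fun n => ENNReal.ofReal ((n : ℝ) ^ (-s))
  have hw (f : Fin h → ℕ) : ∏ i, w (f i) = w (∏ i, f i) := by
    simp only [w]
    rw [← ENNReal.ofReal_prod_of_nonneg fun i _ => by positivity,
      Real.finsetProd_rpow _ _ fun i _ => by positivity]
    push_cast
    rfl
  calc ∑ n ∈ Finset.range N, ENNReal.ofReal ((mulRepFam h A n : ℝ) * (n : ℝ) ^ (-s))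
      ≤ ∑ n ∈ Finset.range N, ∑ f ∈ (Fintype.piFinset T).filter (fun f => ∏ i, f i = n),
          ∏ i, w (f i) := by
        refine Finset.sum_le_sum fun n hn => ?_
        rcases Nat.eq_zero_or_pos n with rfl | hn1
        · simp [Real.zero_rpow (neg_ne_zero.2 hs.ne')]
        · rw [mulRepFam_eq_card h A hA0 hn1 (Finset.mem_range.1 hn).le,
            Finset.sum_congr rfl (g := fun _ => w n)
              fun f hf => by rw [hw, (Finset.mem_filter.1 hf).2],
            Finset.sum_const, nsmul_eq_mul, ENNReal.ofReal_mul (by positivity),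
            ENNReal.ofReal_natCast]
    _ = ∑ f ∈ (Fintype.piFinset T).filter (fun f => ∏ i, f i ∈ Finset.range N),
          ∏ i, w (f i) := by
        rw [← Finset.sum_fiberwise_of_maps_to (s := (Fintype.piFinset T).filter
          (fun f => ∏ i, f i ∈ Finset.range N)) (t := Finset.range N) (g := fun f => ∏ i, f i)
          fun f hf => (Finset.mem_filter.1 hf).2]
        refine Finset.sum_congr rfl fun n hn => Finset.sum_congr ?_ fun _ _ => rfl
        ext f
        simp only [Finset.mem_filter]
        constructor
        · rintro ⟨h1, rfl⟩; exact ⟨⟨h1, hn⟩, rfl⟩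
        · rintro ⟨⟨h1, -⟩, h2⟩; exact ⟨h1, h2⟩
    _ ≤ ∑ f ∈ Fintype.piFinset T, ∏ i, w (f i) :=
        Finset.sum_le_sum_of_subset (Finset.filter_subset _ _)
    _ = ∏ i, ∑ n ∈ T i, w n := (Finset.prod_univ_sum T fun _ n => w n).symm
    _ ≤ _ := by
        refine Finset.prod_le_prod' fun i _ => ?_
        refine le_trans (Finset.sum_le_sum fun n hn => ?_) (ENNReal.sum_le_tsum (T i))
        rw [if_pos (Finset.mem_filter.1 hn).2, one_mul]

open Classical in
lemma cntF_eq_sum (A : Set ℕ) (x : ℝ) :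
    (cntF A x : ℝ) = ∑ n ∈ Finset.Icc 1 ⌊x⌋₊, if n ∈ A then (1 : ℝ) else 0 := by
  rw [Finset.sum_boole, cntF, ← Set.ncard_coe_finset]
  congr 2
  ext n
  simp only [Set.mem_inter_iff, Set.mem_Icc, Finset.coe_filter, Finset.mem_Icc, Set.mem_ofPred_eq]
  tauto

open Classical in
lemma le_prod_mul_Gamma (h : ℕ) (A : Fin h → Set ℕ) (hA0 : ∀ i, 0 ∉ A i)
    (τ : Fin h → ℝ) (hτ : ∀ i, 0 < τ i) (hsum : ∑ i, τ i = 1) {l : ℝ} (hl : 0 ≤ l)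
    {c : Fin h → ℝ} (hc : ∀ i, 0 ≤ c i)
    (hlow : ∀ᶠ x : ℝ in atTop, l < (∑ n ∈ Finset.Icc 1 ⌊x⌋₊, (mulRepFam h A n : ℝ)) / x)
    (hup : ∀ i, ∀ᶠ x : ℝ in atTop, (cntF (A i) x : ℝ) * Real.log x ^ (1 - τ i) / x < c i) :
    l ≤ ∏ i, (c i * Real.Gamma (τ i)) := by
  obtain ⟨u₀, hu₀, H⟩ : ∃ u₀ : ℝ, 0 < u₀ ∧ ∀ u, u₀ ≤ u →
      l < (∑ n ∈ Finset.Icc 1 ⌊Real.exp u⌋₊, (mulRepFam h A n : ℝ)) / Real.exp u ∧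
      ∀ i, (cntF (A i) (Real.exp u) : ℝ) * u ^ (1 - τ i) / Real.exp u < c i := by
    have := Real.tendsto_exp_atTop.eventually (hlow.and (eventually_all.2 hup))
    obtain ⟨u₁, h₁⟩ := eventually_atTop.1 this
    refine ⟨max u₁ 1, by positivity, fun u hu => ?_⟩
    have := h₁ u ((le_max_left _ _).trans hu)
    simpa only [Real.log_exp] using this
  have main : ∀ σ : ℝ, 0 < σ → l * (1 + σ) * Real.exp (-σ * u₀) ≤
      ∏ i, (σ ^ τ i * Real.exp u₀ + c i * (1 + σ) * Real.Gamma (τ i)) := by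
    intro σ hσ
    have hG i := Real.Gamma_pos_of_pos (hτ i)
    have hpos : ∀ i, 0 ≤
        Real.exp u₀ + c i * (1 + σ) * ((1 / σ) ^ τ i * Real.Gamma (τ i)) := fun i => by
      have := hG i
      have := hc i
      positivity
    have h1 := le_dirichletSeries (f := fun n => (mulRepFam h A n : ℝ))
      (fun n => Nat.cast_nonneg _) hl (u₀ := u₀)
      (fun u hu => ((lt_div_iff₀ (Real.exp_pos u)).1 (H u hu).1).le) hσ
    have h2 := tsum_mulRepFam_le_prod h A hA0 (s := 1 + σ) (by linarith)
    have h3 : ∏ i, ∑' n : ℕ,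
        ENNReal.ofReal ((if n ∈ A i then 1 else 0) * (n : ℝ) ^ (-(1 + σ))) ≤
        ∏ i, ENNReal.ofReal
          (Real.exp u₀ + c i * (1 + σ) * ((1 / σ) ^ τ i * Real.Gamma (τ i))) := by
      refine Finset.prod_le_prod' fun i _ => dirichletSeries_le (fun n => by positivity)
        (fun n => by split_ifs <;> norm_num) (hc i) (hτ i) hu₀ (fun u hu => ?_) hσ
      have hu0 : 0 < u := hu₀.trans_le hu
      rw [← cntF_eq_sum]
      have h4 := (H u hu).2 i
      rw [div_lt_iff₀ (Real.exp_pos u)] at h4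
      have h5 : u ^ (1 - τ i) * u ^ (τ i - 1) = 1 := by
        rw [← Real.rpow_add hu0]; simp
      calc (cntF (A i) (Real.exp u) : ℝ)
          = cntF (A i) (Real.exp u) * u ^ (1 - τ i) * u ^ (τ i - 1) := by
            rw [mul_assoc, h5, mul_one]
        _ ≤ c i * Real.exp u * u ^ (τ i - 1) := by gcongr
        _ = _ := by ring
    have h4 := h1.trans (h2.trans h3)
    rw [← ENNReal.ofReal_prod_of_nonneg fun i _ => hpos i,
      ENNReal.ofReal_le_ofReal_iff (Finset.prod_nonneg fun i _ => hpos i)] at h4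
    calc l * (1 + σ) * Real.exp (-σ * u₀)
        = (∏ i, σ ^ τ i) * (l * (1 + σ) * (Real.exp (-σ * u₀) / σ)) := by
          rw [← Real.rpow_sum_of_pos hσ, hsum, Real.rpow_one]; field_simp
      _ ≤ (∏ i, σ ^ τ i) *
          ∏ i, (Real.exp u₀ + c i * (1 + σ) * ((1 / σ) ^ τ i * Real.Gamma (τ i))) := by
          gcongr
      _ = _ := by
          rw [← Finset.prod_mul_distrib]
          refine Finset.prod_congr rfl fun i _ => ?_
          have : σ ^ τ i ≠ 0 := (Real.rpow_pos_of_pos hσ _).ne'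
          rw [one_div, Real.inv_rpow hσ.le]
          field_simp
  have t1 : Tendsto (fun σ : ℝ => l * (1 + σ) * Real.exp (-σ * u₀)) (nhdsWithin 0 (Set.Ioi 0))
      (nhds l) := by
    have : Continuous fun σ : ℝ => l * (1 + σ) * Real.exp (-σ * u₀) := by fun_prop
    simpa using (this.tendsto 0).mono_left nhdsWithin_le_nhds
  have t2 : Tendsto
      (fun σ : ℝ => ∏ i, (σ ^ τ i * Real.exp u₀ + c i * (1 + σ) * Real.Gamma (τ i)))
      (nhdsWithin 0 (Set.Ioi 0)) (nhds (∏ i, (c i * Real.Gamma (τ i)))) := by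
    have : Continuous
        fun σ : ℝ => ∏ i, (σ ^ τ i * Real.exp u₀ + c i * (1 + σ) * Real.Gamma (τ i)) := by
      refine continuous_finsetProd _ fun i _ => ?_
      have := Real.continuous_rpow_const (hτ i).le
      fun_prop
    simpa [Real.zero_rpow (hτ _).ne'] using (this.tendsto 0).mono_left nhdsWithin_le_nhds
  exact le_of_tendsto_of_tendsto t1 t2
    (eventually_nhdsWithin_of_forall fun σ hσ => main σ hσ)

lemma EReal.coe_finsetProd {ι : Type*} (s : Finset ι) (f : ι → ℝ) :
    ((∏ i ∈ s, f i : ℝ) : EReal) = ∏ i ∈ s, (f i : EReal) := by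
  classical
  induction s using Finset.induction_on with
  | empty => simp
  | insert a s ha ih => rw [Finset.prod_insert ha, Finset.prod_insert ha, EReal.coe_mul, ih]

theorem stmt2 (h : ℕ) (hh : 1 ≤ h) (A : Fin h → Set ℕ) (hA0 : ∀ i, 0 ∉ A i)
    (τ : Fin h → ℝ) (hτ : ∀ i, τ i ∈ Set.Ioo (0 : ℝ) 1) (hsum : ∑ i, τ i = 1)
    (hfin : ∀ i, Filter.limsup (fun x : ℝ =>
      (((cntF (A i) x : ℝ) * Real.log x ^ (1 - τ i) / x : ℝ) : EReal)) Filter.atTop < ⊤) :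
    Filter.liminf (fun x : ℝ =>
        (((∑ n ∈ Finset.Icc 1 ⌊x⌋₊, (mulRepFam h A n : ℝ)) / x : ℝ) : EReal)) Filter.atTop
      * ∏ i, (((Real.Gamma (τ i))⁻¹ : ℝ) : EReal)
    ≤ ∏ i, Filter.limsup (fun x : ℝ =>
        (((cntF (A i) x : ℝ) * Real.log x ^ (1 - τ i) / x : ℝ) : EReal)) Filter.atTop := by
  have hL : ∀ i, ∃ L : ℝ, 0 ≤ L ∧ Filter.limsup (fun x : ℝ =>
      (((cntF (A i) x : ℝ) * Real.log x ^ (1 - τ i) / x : ℝ) : EReal)) Filter.atTop = L := by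
    intro i
    have h0 : 0 ≤ Filter.limsup (fun x : ℝ =>
        (((cntF (A i) x : ℝ) * Real.log x ^ (1 - τ i) / x : ℝ) : EReal)) Filter.atTop := by
      refine le_limsup_of_frequently_le (Eventually.frequently ?_)
      filter_upwards [eventually_ge_atTop (1 : ℝ)] with x hx
      have := Real.log_nonneg hx
      exact_mod_cast (by positivity :
        (0 : ℝ) ≤ (cntF (A i) x : ℝ) * Real.log x ^ (1 - τ i) / x)
    have h1 := EReal.coe_toReal (hfin i).ne (ne_bot_of_le_ne_bot EReal.zero_ne_bot h0)
    exact ⟨_, EReal.toReal_nonneg h0, h1.symm⟩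
  choose L hL0 hL using hL
  simp_rw [hL]
  have hG i := Real.Gamma_pos_of_pos (hτ i).1
  have hle : Filter.liminf (fun x : ℝ =>
        (((∑ n ∈ Finset.Icc 1 ⌊x⌋₊, (mulRepFam h A n : ℝ)) / x : ℝ) : EReal)) Filter.atTop
      ≤ ((∏ i, (L i * Real.Gamma (τ i)) : ℝ) : EReal) := by
    by_contra! hlt
    obtain ⟨l, hl1, hl2⟩ := EReal.lt_iff_exists_real_btwn.1 hlt
    rw [EReal.coe_lt_coe_iff] at hl1
    refine hl1.not_ge ?_
    have hlow := eventually_lt_of_lt_liminf hl2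
    simp only [EReal.coe_lt_coe_iff] at hlow
    have hl0 : 0 ≤ l := (Finset.prod_nonneg fun i _ => mul_nonneg (hL0 i) (hG i).le).trans hl1.le
    have hε : ∀ ε : ℝ, 0 < ε → l ≤ ∏ i, ((L i + ε) * Real.Gamma (τ i)) := by
      intro ε hε
      refine le_prod_mul_Gamma h A hA0 τ (fun i => (hτ i).1) hsum hl0
        (fun i => add_nonneg (hL0 i) hε.le) hlow fun i => ?_
      have : Filter.limsup (fun x : ℝ =>
          (((cntF (A i) x : ℝ) * Real.log x ^ (1 - τ i) / x : ℝ) : EReal)) Filter.atTop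
          < ((L i + ε : ℝ) : EReal) := by
        rw [hL i, EReal.coe_lt_coe_iff]; linarith
      simpa only [EReal.coe_lt_coe_iff] using eventually_lt_of_limsup_lt this
    have hcont : Continuous fun ε : ℝ => ∏ i, ((L i + ε) * Real.Gamma (τ i)) := by fun_prop
    have ht : Tendsto (fun ε : ℝ => ∏ i, ((L i + ε) * Real.Gamma (τ i)))
        (nhdsWithin 0 (Set.Ioi 0)) (nhds (∏ i, (L i * Real.Gamma (τ i)))) := by
      simpa using (hcont.tendsto 0).mono_left nhdsWithin_le_nhds
    exact ge_of_tendsto ht (eventually_nhdsWithin_of_forall fun ε h => hε ε h)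
  rw [← EReal.coe_finsetProd, ← EReal.coe_finsetProd]
  refine (mul_le_mul_of_nonneg_right hle ?_).trans_eq ?_
  · exact_mod_cast Finset.prod_nonneg fun i _ => (inv_pos.2 (hG i)).le
  · rw [← EReal.coe_mul, ← Finset.prod_mul_distrib]
    congr 1
    exact Finset.prod_congr rfl fun i _ => by have := (hG i).ne'; field_simp
end
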